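/- arXiv:1904.12240 — 3 statements merged into one kernel-verified Lean document; each statement's English description precedes it below -/
import Mathlib

section
/- Let h₁ ≥ h₂ ≥ h₃ ≥ 0 and let y₁, y₂, y₃ ≥ 0 satisfy y₁ + y₂ + y₃ ≤ 1. Then for every permutation (i,j,k) of (1,2,3), V_{ijk}(y,h) ≤ V_{123}(y,h). In other words, the triangular-cell volume V(y,h) of equation (1), computed with indices sorted so that thicknesses are non-increasing, equals the maximum of V_{ijk}(y,h) over all six permutations (i,j,k). -/
/-- The triangular-cell volume of equation (1) for the ordering `(i, j, k)`:
`V_{ijk}(y,h) = (2−yᵢ)yᵢhᵢ + (2−2yᵢ−yⱼ)yⱼhⱼ + (2−2yᵢ−2yⱼ−yₖ)yₖhₖ`. -/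
def Vperm (y h : Fin 3 → ℝ) (i j k : Fin 3) : ℝ :=
  (2 - y i) * y i * h i + (2 - 2 * y i - y j) * y j * h j +
    (2 - 2 * y i - 2 * y j - y k) * y k * h k

/-- If `h₁ ≥ h₂ ≥ h₃ ≥ 0` and `y₁, y₂, y₃ ≥ 0` with `y₁ + y₂ + y₃ ≤ 1`, then the
cell volume computed with thicknesses sorted in non-increasing order is the greatest
among the values `V_{ijk}(y,h)` over all six permutations `(i,j,k)` of `(1,2,3)`. -/
theorem sorted_volume_is_max (y h : Fin 3 → ℝ)
    (h01 : h 1 ≤ h 0) (h12 : h 2 ≤ h 1) (h2 : 0 ≤ h 2)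
    (hy : ∀ i, 0 ≤ y i) (hsum : y 0 + y 1 + y 2 ≤ 1) :
    IsGreatest {v : ℝ | ∃ σ : Equiv.Perm (Fin 3), v = Vperm y h (σ 0) (σ 1) (σ 2)}
      (Vperm y h 0 1 2) := by
  refine ⟨⟨1, rfl⟩, ?_⟩
  rintro _ ⟨σ, rfl⟩
  have d01 : σ 0 ≠ σ 1 := σ.injective.ne (by decide)
  have d02 : σ 0 ≠ σ 2 := σ.injective.ne (by decide)
  have d12 : σ 1 ≠ σ 2 := σ.injective.ne (by decide)
  have p01 : 0 ≤ y 0 * y 1 * (h 0 - h 1) :=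
    mul_nonneg (mul_nonneg (hy 0) (hy 1)) (by linarith)
  have p02 : 0 ≤ y 0 * y 2 * (h 0 - h 2) :=
    mul_nonneg (mul_nonneg (hy 0) (hy 2)) (by linarith)
  have p12 : 0 ≤ y 1 * y 2 * (h 1 - h 2) :=
    mul_nonneg (mul_nonneg (hy 1) (hy 2)) (by linarith)
  generalize σ 0 = i at *
  generalize σ 1 = j at *
  generalize σ 2 = k at *
  unfold Vperm
  fin_cases i <;> fin_cases j <;> fin_cases k <;> simp at d01 d02 d12 ⊢ <;> linarith
end

section
/- Assume gᵗᵢ ≥ 0 and g^bᵢ ≥ 0 for i = 1, 2, 3, with g^b₁ > 0, and A > 0. Then V has no local minimum at any point of the open positive orthant {z ∈ ℝ³ : z₁ > 0, z₂ > 0, z₃ > 0}: for every such point z₀ there exist points arbitrarily close to z₀ (in the orthant) at which V takes a strictly smaller value. (Hence any constrained minimum of the local cell-optimization problem lies on the boundary of the feasible domain.) -/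
/-- The normalized block width `yᵢ(z) = gᵗᵢ zᵢ + 6 g^bᵢ zᵢ²` in the reciprocal-thickness
variables `zᵢ = 1/hᵢ`. -/
def cellWidth (gt gb : Fin 3 → ℝ) (z : Fin 3 → ℝ) (i : Fin 3) : ℝ :=
  gt i * z i + 6 * gb i * z i ^ 2

/-- The triangular-cell volume `V(z)` of equation (1) expressed in the reciprocal
thickness variables `zᵢ = 1/hᵢ` after eliminating the widths via the critical-stress
constraints. -/
def cellVol (A : ℝ) (gt gb : Fin 3 → ℝ) (z : Fin 3 → ℝ) : ℝ :=
  A * ((2 - cellWidth gt gb z 0) * (gt 0 + 6 * gb 0 * z 0) +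
       (2 - 2 * cellWidth gt gb z 0 - cellWidth gt gb z 1) * (gt 1 + 6 * gb 1 * z 1) +
       (2 - 2 * cellWidth gt gb z 0 - 2 * cellWidth gt gb z 1 - cellWidth gt gb z 2) *
         (gt 2 + 6 * gb 2 * z 2))

/-- The second central difference of `V` in the direction of `z₁`. -/
lemma cellVol_second_difference (A : ℝ) (gt gb z : Fin 3 → ℝ) (d : ℝ) :
    cellVol A gt gb (Function.update z 0 (z 0 + d)) +
        cellVol A gt gb (Function.update z 0 (z 0 - d)) - 2 * cellVol A gt gb z =
      -(12 * A * gb 0 * d ^ 2 * (2 * gt 0 + 18 * gb 0 * z 0 +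
        2 * (gt 1 + 6 * gb 1 * z 1) + 2 * (gt 2 + 6 * gb 2 * z 2))) := by
  simp [cellVol, cellWidth]
  ring

lemma dist_update_lt {ι : Type*} [Fintype ι] [DecidableEq ι] (z : ι → ℝ) (i : ι) {a ε : ℝ}
    (hε : 0 < ε) (h : |a - z i| < ε) : dist (Function.update z i a) z < ε := by
  refine (dist_pi_lt_iff hε).2 fun j => ?_
  by_cases hj : j = i
  · subst hj
    simpa [Real.dist_eq] using h
  · simpa [hj] using hε

lemma update_pos {ι : Type*} [DecidableEq ι] {z : ι → ℝ} (hz : ∀ i, 0 < z i) (i : ι) {a : ℝ}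
    (ha : 0 < a) : ∀ j, 0 < Function.update z i a j :=
  Function.forall_update_iff z (fun _ x => 0 < x) |>.2 ⟨ha, fun j _ => hz j⟩

/-- If `g^b₁ > 0`, the cell volume `V` has no local minimum at any point of the open
positive orthant: arbitrarily close to any such point there are points of the orthant
where `V` is strictly smaller.  Hence any constrained minimum of the local
cell-optimization problem lies on the boundary of the feasible domain. -/
theorem cellVol_no_interior_local_min (A : ℝ) (gt gb : Fin 3 → ℝ) (hA : 0 < A)
    (hgt : ∀ i, 0 ≤ gt i) (hgb : ∀ i, 0 ≤ gb i) (hgb1 : 0 < gb 0) :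
    ∀ z : Fin 3 → ℝ, (∀ i, 0 < z i) →
      ∀ ε : ℝ, 0 < ε → ∃ z' : Fin 3 → ℝ, (∀ i, 0 < z' i) ∧ dist z' z < ε ∧
        cellVol A gt gb z' < cellVol A gt gb z := by
  intro z hz ε hε
  obtain ⟨d, hd, hdlt⟩ := exists_between (lt_min hε (hz 0))
  obtain ⟨hdε, hdz⟩ := lt_min_iff.1 hdlt
  have hpos : 0 < 12 * A * gb 0 * d ^ 2 * (2 * gt 0 + 18 * gb 0 * z 0 +
      2 * (gt 1 + 6 * gb 1 * z 1) + 2 * (gt 2 + 6 * gb 2 * z 2)) := by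
    have := hgt 0
    have := hgt 1
    have := hgt 2
    have := hgb 1
    have := hgb 2
    have := hz 0
    have := hz 1
    have := hz 2
    positivity
  have hsum := cellVol_second_difference A gt gb z d
  by_cases h : cellVol A gt gb (Function.update z 0 (z 0 + d)) < cellVol A gt gb z
  · refine ⟨_, update_pos hz 0 (by linarith [hz 0]), dist_update_lt z 0 hε ?_, h⟩
    simpa [abs_of_pos hd] using hdε
  · refine ⟨Function.update z 0 (z 0 - d), update_pos hz 0 (by linarith),
      dist_update_lt z 0 hε ?_, by linarith⟩
    simpa [abs_of_pos hd] using hdε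
end

section
/- Assume gᵗᵢ > 0 and g^bᵢ ≥ 0 for i = 1, 2, 3, A > 0, z_min > 0, and let S = {z ∈ ℝ³ : z_min ≤ z₁ ≤ z₂ ≤ z₃ and y₁(z) + y₂(z) + y₃(z) ≤ 1}, assumed nonempty. Then S is compact, V attains its minimum over S, and every global minimizer z* of V on S satisfies at least one of: (i) z* = (z_min, z_min, z_min) (all three blocks have maximal thickness), or (ii) y₁(z*) + y₂(z*) + y₃(z*) = 1 (the cell is filled). -/
/-- A cubic `M + K (c + b t) - t (c + b t)²` with `c > 0`, `b ≥ 0` has no local minimum at a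
positive point: it is strictly concave there if `b > 0` and strictly decreasing if `b = 0`. -/
theorem not_isLocalMin_blockCubic {c b : ℝ} (hc : 0 < c) (hb : 0 ≤ b) (M K : ℝ) {t : ℝ}
    (ht : 0 < t) :
    ¬ IsLocalMin (fun s : ℝ => M + K * (c + b * s) - s * (c + b * s) ^ 2) t := by
  intro h
  obtain ⟨ε, hε, hball⟩ := Metric.eventually_nhds_iff.1 h
  have hplus := hball (y := t + ε / 2) (by
    rw [Real.dist_eq, abs_lt]; constructor <;> linarith)
  have hminus := hball (y := t - ε / 2) (by
    rw [Real.dist_eq, abs_lt]; constructor <;> linarith)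
  rcases hb.eq_or_lt with rfl | hb
  · have : 0 < ε * c ^ 2 := by positivity
    linarith
  · have h₁ : 0 < ε ^ 2 * (c * b) := by positivity
    have h₂ : 0 < ε ^ 2 * (b ^ 2 * t) := by positivity
    linarith

/-- If a curve `w` stays in `S` near a positive parameter `t`, and the volume along it is
a block cubic, then `w t` does not minimize the volume on `S`. -/
theorem not_min_of_blockCubic {A : ℝ} (hA : 0 < A) {gt gb : Fin 3 → ℝ} {S : Set (Fin 3 → ℝ)}
    {w : ℝ → Fin 3 → ℝ} {c b : ℝ} (hc : 0 < c) (hb : 0 ≤ b) (M K : ℝ) {t : ℝ} (ht : 0 < t)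
    (hw : ∀ᶠ s in nhds t, w s ∈ S)
    (hV : ∀ s, cellVol A gt gb (w s) = A * (M + K * (c + b * s) - s * (c + b * s) ^ 2)) :
    ¬ ∀ z ∈ S, cellVol A gt gb (w t) ≤ cellVol A gt gb z := by
  intro hmin
  refine not_isLocalMin_blockCubic hc hb M K ht ?_
  filter_upwards [hw] with s hs
  have h := hmin _ hs
  rw [hV, hV] at h
  exact le_of_mul_le_mul_left h hA

theorem continuous_cellWidth (gt gb : Fin 3 → ℝ) (i : Fin 3) :
    Continuous fun z => cellWidth gt gb z i := by
  unfold cellWidth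
  fun_prop

theorem continuous_cellVol (A : ℝ) (gt gb : Fin 3 → ℝ) : Continuous (cellVol A gt gb) := by
  unfold cellVol cellWidth
  fun_prop

/-- The set of admissible reciprocal thicknesses is compact. -/
theorem isCompact_feasible {zmin : ℝ} {gt gb : Fin 3 → ℝ} (hzmin : 0 < zmin)
    (hgt : ∀ i, 0 < gt i) (hgb : ∀ i, 0 ≤ gb i) :
    IsCompact {z : Fin 3 → ℝ | zmin ≤ z 0 ∧ z 0 ≤ z 1 ∧ z 1 ≤ z 2 ∧
      cellWidth gt gb z 0 + cellWidth gt gb z 1 + cellWidth gt gb z 2 ≤ 1} := by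
  refine (isCompact_Icc (a := fun _ => zmin) (b := fun i => 1 / gt i)).of_isClosed_subset ?_ ?_
  · have h := continuous_cellWidth gt gb
    exact (isClosed_le continuous_const (continuous_apply 0)).inter
      ((isClosed_le (continuous_apply 0) (continuous_apply 1)).inter
        ((isClosed_le (continuous_apply 1) (continuous_apply 2)).inter
          (isClosed_le (((h 0).add (h 1)).add (h 2)) continuous_const)))
  · rintro z ⟨h0, h1, h2, hy⟩
    have hz : ∀ i, zmin ≤ z i := by
      intro i
      fin_cases i <;> simp only [Fin.zero_eta, Fin.mk_one, Fin.reduceFinMk] <;> linarith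
    have hle : ∀ i, gt i * z i ≤ cellWidth gt gb z i := fun i => by
      have := mul_nonneg (hgb i) (sq_nonneg (z i))
      unfold cellWidth
      linarith
    have hnn : ∀ i, 0 ≤ cellWidth gt gb z i := fun i =>
      (mul_pos (hgt i) (hzmin.trans_le (hz i))).le.trans (hle i)
    refine ⟨hz, fun i => ?_⟩
    have h1 : cellWidth gt gb z i ≤ 1 := by
      have := hnn 0
      have := hnn 1
      have := hnn 2
      fin_cases i <;> simp only [Fin.zero_eta, Fin.mk_one, Fin.reduceFinMk] <;> linarith
    rw [le_div_iff₀ (hgt i)]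
    linarith [hle i]

/-- Structure of the local-step minimizers (Proposition 5.1): on the nonempty feasible
set `S = {z : z_min ≤ z₁ ≤ z₂ ≤ z₃, y₁(z)+y₂(z)+y₃(z) ≤ 1}`, with all `gᵗᵢ > 0`,
`g^bᵢ ≥ 0`, `A > 0` and `z_min > 0`, the set `S` is compact, `V` attains its minimum
on `S`, and every global minimizer either has all blocks at maximal thickness
(`z = (z_min, z_min, z_min)`) or fills the cell (`y₁ + y₂ + y₃ = 1`). -/
theorem cellVol_min_on_boundary (A zmin : ℝ) (gt gb : Fin 3 → ℝ) (hA : 0 < A)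
    (hzmin : 0 < zmin) (hgt : ∀ i, 0 < gt i) (hgb : ∀ i, 0 ≤ gb i)
    (S : Set (Fin 3 → ℝ))
    (hS : S = {z : Fin 3 → ℝ | zmin ≤ z 0 ∧ z 0 ≤ z 1 ∧ z 1 ≤ z 2 ∧
      cellWidth gt gb z 0 + cellWidth gt gb z 1 + cellWidth gt gb z 2 ≤ 1})
    (hne : S.Nonempty) :
    IsCompact S ∧
    (∃ z ∈ S, ∀ z' ∈ S, cellVol A gt gb z ≤ cellVol A gt gb z') ∧
    (∀ z ∈ S, (∀ z' ∈ S, cellVol A gt gb z ≤ cellVol A gt gb z') →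
      z = (fun _ => zmin) ∨
      cellWidth gt gb z 0 + cellWidth gt gb z 1 + cellWidth gt gb z 2 = 1) := by
  have hcompact : IsCompact S := hS ▸ isCompact_feasible hzmin hgt hgb
  refine ⟨hcompact, hcompact.exists_isMinOn hne (continuous_cellVol A gt gb).continuousOn, ?_⟩
  intro z hz hmin
  by_contra! hcon
  obtain ⟨hne_min, hne_one⟩ := hcon
  rw [hS] at hz
  obtain ⟨h0, h1, h2, hy⟩ := hz
  have hlt := lt_of_le_of_ne hy hne_one
  have hwidth : ∀ w : ℝ → Fin 3 → ℝ, Continuous w → w (z 2) = z → ∀ᶠ s in nhds (z 2),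
      cellWidth gt gb (w s) 0 + cellWidth gt gb (w s) 1 + cellWidth gt gb (w s) 2 < 1 := by
    intro w hw hwz
    have h := fun i => (continuous_cellWidth gt gb i).comp hw
    refine (((h 0).add (h 1)).add (h 2)).continuousAt.eventually_lt_const ?_
    simpa [hwz] using hlt
  have ht : 0 < z 2 := by linarith
  have key : ∀ (w : ℝ → Fin 3 → ℝ) (c b M K : ℝ), Continuous w → w (z 2) = z → 0 < c → 0 ≤ b →
      (∀ᶠ s in nhds (z 2), zmin ≤ w s 0 ∧ w s 0 ≤ w s 1 ∧ w s 1 ≤ w s 2) →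
      (∀ s, cellVol A gt gb (w s) = A * (M + K * (c + b * s) - s * (c + b * s) ^ 2)) →
      False := by
    intro w c b M K hw hwz hc hb hord hV
    refine not_min_of_blockCubic hA hc hb M K ht (S := S) ?_ hV (hwz.symm ▸ hmin)
    filter_upwards [hord, hwidth w hw hwz] with s ho hs
    rw [hS]
    exact ⟨ho.1, ho.2.1, ho.2.2, hs.le⟩
  have hgt0 := hgt 0
  have hgt1 := hgt 1
  have hgt2 := hgt 2
  have hgb0 := hgb 0
  have hgb1 := hgb 1
  have hgb2 := hgb 2
  rcases h2.lt_or_eq with h2 | h2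
  · refine key (fun s => ![z 0, z 1, s]) (gt 2) (6 * gb 2)
      ((2 - cellWidth gt gb z 0) * (gt 0 + 6 * gb 0 * z 0) +
        (2 - 2 * cellWidth gt gb z 0 - cellWidth gt gb z 1) * (gt 1 + 6 * gb 1 * z 1))
      (2 - 2 * cellWidth gt gb z 0 - 2 * cellWidth gt gb z 1)
      (by fun_prop) (by ext i; fin_cases i <;> rfl) hgt2 (by positivity) ?_ ?_
    · filter_upwards [lt_mem_nhds h2] with s hs
      exact ⟨h0, h1, hs.le⟩
    · intro s
      simp only [cellVol, cellWidth, Matrix.cons_val]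
      ring
  rcases h1.lt_or_eq with h1 | h1
  · refine key (fun s => ![z 0, s, s]) (gt 1 + gt 2) (6 * (gb 1 + gb 2))
      ((2 - cellWidth gt gb z 0) * (gt 0 + 6 * gb 0 * z 0))
      (2 - 2 * cellWidth gt gb z 0)
      (by fun_prop) (by ext i; fin_cases i <;> simp [h2]) (by positivity) (by positivity) ?_ ?_
    · filter_upwards [lt_mem_nhds (h2 ▸ h1)] with s hs
      exact ⟨h0, hs.le, le_rfl⟩
    · intro s
      simp only [cellVol, cellWidth, Matrix.cons_val]
      ring
  have h0' : zmin < z 2 := by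
    refine lt_of_le_of_ne (by linarith) fun h => hne_min ?_
    ext i
    fin_cases i <;> simp [h, h1, h2]
  refine key (fun s => ![s, s, s]) (gt 0 + gt 1 + gt 2) (6 * (gb 0 + gb 1 + gb 2)) 0 2
    (by fun_prop) (by ext i; fin_cases i <;> simp [h1, h2]) (by positivity) (by positivity) ?_ ?_
  · filter_upwards [lt_mem_nhds h0'] with s hs
    exact ⟨hs.le, le_rfl, le_rfl⟩
  · intro s
    simp only [cellVol, cellWidth, Matrix.cons_val]
    ring
end
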